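/- Let τ₁, τ₂, τ₃ ∈ ℝ with τ_j ≠ ±2 for j = 1, 2, 3, let 0 < ω < ω₂ < 2π − ω, and let λ ∈ ℝ. Set p_j := 1 − τ_j²/4 and m_j := 1 + τ_j²/4. Then the following system of six linear equations in the unknowns (c₁₁, c₁₂, c₂₁, c₂₂, c₃₁, c₃₂) ∈ ℂ⁶ — (1) c₁₁ = (m₁/p₁)·e^{2πiλ}·c₃₁ − (τ₁/p₁)·e^{i(ω(2λ+1)−2πλ)}·c₃₂; (2) c₁₂ = −(τ₁/p₁)·e^{−i(ω(2λ+1)−2πλ)}·c₃₁ + (m₁/p₁)·e^{−2πiλ}·c₃₂; (3) c₁₁ = (m₂/p₂)·c₂₁ + (τ₂/p₂)·e^{−iω(2λ+1)}·c₂₂; (4) c₁₂ = (τ₂/p₂)·e^{iω(2λ+1)}·c₂₁ + (m₂/p₂)·c₂₂; (5) c₂₁ = (m₃/p₃)·c₃₁ + (τ₃/p₃)·e^{−iω₂(2λ+1)}·c₃₂; (6) c₂₂ = (τ₃/p₃)·e^{iω₂(2λ+1)}·c₃₁ + (m₃/p₃)·c₃₂ — has a nonzero solution if and only if 0 = p₁p₂p₃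 − m₁m₂m₃·cos(2πλ) − m₁τ₂τ₃·cos((ω₂−ω)(2λ+1) − 2πλ) − m₂τ₁τ₃·cos(−(ω+ω₂)(2λ+1) + 2πλ) − m₃τ₁τ₂·cos(2ω(2λ+1) − 2πλ). -/

import Mathlib

noncomputable section

/-- A homogeneous `2 × 2` linear system has a nonzero solution iff its determinant vanishes. -/
lemma exists_ne_zero_two_by_two_iff {K : Type*} [Field K] (a b c d : K) :
    (∃ x y : K, ¬(x = 0 ∧ y = 0) ∧ a * x + b * y = 0 ∧ c * x + d * y = 0) ↔
      a * d - b * c = 0 := by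
  rw [← Matrix.det_fin_two_of, ← Matrix.exists_mulVec_eq_zero_iff]
  constructor
  · rintro ⟨x, y, hxy, hx, hy⟩
    refine ⟨![x, y], fun h => hxy ⟨congrFun h 0, congrFun h 1⟩, ?_⟩
    ext i
    fin_cases i <;> simp [Matrix.mulVec, dotProduct, Fin.sum_univ_two, hx, hy]
  · rintro ⟨v, hv, h⟩
    refine ⟨v 0, v 1, fun h0 => hv ?_, ?_, ?_⟩
    · ext i
      fin_cases i
      exacts [h0.1, h0.2]
    · simpa [Matrix.mulVec, dotProduct, Fin.sum_univ_two] using congrFun h 0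
    · simpa [Matrix.mulVec, dotProduct, Fin.sum_univ_two] using congrFun h 1

/-- The three-edge transmission system over a field, with the phases `E`, `G`, `H` as
independent nonzero parameters. -/
lemma exists_transmission_solution_iff {K : Type*} [Field K]
    {p1 p2 p3 m1 m2 m3 t1 t2 t3 E G H : K}
    (hp1 : p1 ≠ 0) (hp2 : p2 ≠ 0) (hp3 : p3 ≠ 0)
    (hm1 : m1 ^ 2 - t1 ^ 2 = p1 ^ 2) (hm2 : m2 ^ 2 - t2 ^ 2 = p2 ^ 2)
    (hm3 : m3 ^ 2 - t3 ^ 2 = p3 ^ 2) (hE : E ≠ 0) (hG : G ≠ 0) (hH : H ≠ 0) :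
    (∃ c11 c12 c21 c22 c31 c32 : K,
      ¬(c11 = 0 ∧ c12 = 0 ∧ c21 = 0 ∧ c22 = 0 ∧ c31 = 0 ∧ c32 = 0) ∧
      c11 = m1 / p1 * E * c31 - t1 / p1 * (G * E⁻¹) * c32 ∧
      c12 = -(t1 / p1) * (G * E⁻¹)⁻¹ * c31 + m1 / p1 * E⁻¹ * c32 ∧
      c11 = m2 / p2 * c21 + t2 / p2 * G⁻¹ * c22 ∧
      c12 = t2 / p2 * G * c21 + m2 / p2 * c22 ∧
      c21 = m3 / p3 * c31 + t3 / p3 * H⁻¹ * c32 ∧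
      c22 = t3 / p3 * H * c31 + m3 / p3 * c32) ↔
    2 * (p1 * p2 * p3) - m1 * m2 * m3 * (E + E⁻¹)
      - m1 * t2 * t3 * (H * G⁻¹ * E⁻¹ + (H * G⁻¹ * E⁻¹)⁻¹)
      - m2 * t1 * t3 * (G * H * E⁻¹ + (G * H * E⁻¹)⁻¹)
      - m3 * t1 * t2 * (G ^ 2 * E⁻¹ + (G ^ 2 * E⁻¹)⁻¹) = 0 := by
  set a := m1 / p1 * E - (m2 * m3 + t2 * t3 * H * G⁻¹) / (p2 * p3) with ha
  set b := -(t1 / p1) * (G * E⁻¹) - (m2 * t3 * H⁻¹ + t2 * m3 * G⁻¹) / (p2 * p3) with hb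
  set c := -(t1 / p1) * (G * E⁻¹)⁻¹ - (t2 * m3 * G + m2 * t3 * H) / (p2 * p3) with hc
  set d := m1 / p1 * E⁻¹ - (m2 * m3 + t2 * t3 * G * H⁻¹) / (p2 * p3) with hd
  have hdet : (a * d - b * c) * (p1 * p2 * p3) =
      2 * (p1 * p2 * p3) - m1 * m2 * m3 * (E + E⁻¹)
      - m1 * t2 * t3 * (H * G⁻¹ * E⁻¹ + (H * G⁻¹ * E⁻¹)⁻¹)
      - m2 * t1 * t3 * (G * H * E⁻¹ + (G * H * E⁻¹)⁻¹)
      - m3 * t1 * t2 * (G ^ 2 * E⁻¹ + (G ^ 2 * E⁻¹)⁻¹) := by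
    have hA : m1 / p1 * E * (m1 / p1 * E⁻¹) -
        -(t1 / p1) * (G * E⁻¹) * (-(t1 / p1) * (G * E⁻¹)⁻¹) = 1 := by
      field_simp
      linear_combination hm1
    have hB : (m2 * m3 + t2 * t3 * H * G⁻¹) / (p2 * p3) *
        ((m2 * m3 + t2 * t3 * G * H⁻¹) / (p2 * p3)) -
        (m2 * t3 * H⁻¹ + t2 * m3 * G⁻¹) / (p2 * p3) *
        ((t2 * m3 * G + m2 * t3 * H) / (p2 * p3)) = 1 := by
      field_simp
      linear_combination (G * H) * (m3 ^ 2 - t3 ^ 2) * hm2 + (G * H) * p2 ^ 2 * hm3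
    have hT : (m1 / p1 * E * ((m2 * m3 + t2 * t3 * G * H⁻¹) / (p2 * p3)) +
        m1 / p1 * E⁻¹ * ((m2 * m3 + t2 * t3 * H * G⁻¹) / (p2 * p3)) +
        t1 / p1 * (G * E⁻¹) * ((t2 * m3 * G + m2 * t3 * H) / (p2 * p3)) +
        t1 / p1 * (G * E⁻¹)⁻¹ * ((m2 * t3 * H⁻¹ + t2 * m3 * G⁻¹) / (p2 * p3)))
          * (p1 * p2 * p3) =
        m1 * m2 * m3 * (E + E⁻¹)
      + m1 * t2 * t3 * (H * G⁻¹ * E⁻¹ + (H * G⁻¹ * E⁻¹)⁻¹)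
      + m2 * t1 * t3 * (G * H * E⁻¹ + (G * H * E⁻¹)⁻¹)
      + m3 * t1 * t2 * (G ^ 2 * E⁻¹ + (G ^ 2 * E⁻¹)⁻¹) := by
      field_simp
      ring
    rw [ha, hb, hc, hd]
    linear_combination (p1 * p2 * p3) * hA + (p1 * p2 * p3) * hB - hT
  rw [← hdet, mul_eq_zero, or_iff_left (by simp [hp1, hp2, hp3]),
    ← exists_ne_zero_two_by_two_iff]
  constructor
  · rintro ⟨c11, c12, c21, c22, x, y, hne, e1, e2, e3, e4, e5, e6⟩
    refine ⟨x, y, ?_, ?_, ?_⟩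
    · rintro ⟨rfl, rfl⟩
      simp_all
    · rw [e5, e6] at e3
      rw [ha, hb]
      linear_combination e3 - e1
    · rw [e5, e6] at e4
      rw [hc, hd]
      linear_combination e4 - e2
  · rintro ⟨x, y, hne, e1, e2⟩
    refine ⟨_, _, _, _, x, y, fun h => hne h.2.2.2.2, rfl, rfl, ?_, ?_, rfl, rfl⟩
    · rw [ha, hb] at e1
      linear_combination e1
    · rw [hc, hd] at e2
      linear_combination e2

lemma one_sub_sq_div_four_ne_zero {t : ℝ} (h : t ≠ 2) (h' : t ≠ -2) : 1 - t ^ 2 / 4 ≠ 0 := by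
  intro h0
  have : (t - 2) * (t + 2) = 0 := by linear_combination -4 * h0
  rcases mul_eq_zero.mp this with h1 | h1
  · exact h (by linarith)
  · exact h' (by linarith)

lemma ofReal_two_mul_cos_eq_of_exp_eq {x : ℝ} {z : ℂ} (h : Complex.exp (Complex.I * x) = z) :
    z + z⁻¹ = 2 * (Real.cos x : ℂ) := by
  rw [← h, ← Complex.exp_neg, Complex.ofReal_cos, Complex.two_cos]
  congr 2 <;> ring

/-- the eigenvalue system for the spin-orbit operator `J₃ − 1/2`
of a star graph with three edges (at angles `−ω`, `ω`, `ω₂`, with Lorentz-scalar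
strengths `τ₁, τ₂, τ₃`) has a nonzero solution iff the displayed determinant
equation holds. -/
theorem threeEdge_system_nonzero_solution_iff
    (τ1 τ2 τ3 ω ω2 lam : ℝ)
    (h1 : τ1 ≠ 2) (h1' : τ1 ≠ -2) (h2 : τ2 ≠ 2) (h2' : τ2 ≠ -2)
    (h3 : τ3 ≠ 2) (h3' : τ3 ≠ -2)
    (hω : 0 < ω) (hωω2 : ω < ω2) (hω2 : ω2 < 2 * Real.pi - ω) :
    let p1 : ℝ := 1 - τ1 ^ 2 / 4
    let p2 : ℝ := 1 - τ2 ^ 2 / 4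
    let p3 : ℝ := 1 - τ3 ^ 2 / 4
    let m1 : ℝ := 1 + τ1 ^ 2 / 4
    let m2 : ℝ := 1 + τ2 ^ 2 / 4
    let m3 : ℝ := 1 + τ3 ^ 2 / 4
    (∃ c11 c12 c21 c22 c31 c32 : ℂ,
      ¬(c11 = 0 ∧ c12 = 0 ∧ c21 = 0 ∧ c22 = 0 ∧ c31 = 0 ∧ c32 = 0) ∧
      c11 = ((m1 / p1 : ℝ) : ℂ) *
              Complex.exp (2 * (Real.pi : ℂ) * Complex.I * (lam : ℂ)) * c31 -
            ((τ1 / p1 : ℝ) : ℂ) *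
              Complex.exp (Complex.I *
                ((ω * (2 * lam + 1) - 2 * Real.pi * lam : ℝ) : ℂ)) * c32 ∧
      c12 = -((τ1 / p1 : ℝ) : ℂ) *
              Complex.exp (-(Complex.I *
                ((ω * (2 * lam + 1) - 2 * Real.pi * lam : ℝ) : ℂ))) * c31 +
            ((m1 / p1 : ℝ) : ℂ) *
              Complex.exp (-(2 * (Real.pi : ℂ) * Complex.I * (lam : ℂ))) * c32 ∧
      c11 = ((m2 / p2 : ℝ) : ℂ) * c21 +
            ((τ2 / p2 : ℝ) : ℂ) *
              Complex.exp (-(Complex.I * ((ω * (2 * lam + 1) : ℝ) : ℂ))) * c22 ∧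
      c12 = ((τ2 / p2 : ℝ) : ℂ) *
              Complex.exp (Complex.I * ((ω * (2 * lam + 1) : ℝ) : ℂ)) * c21 +
            ((m2 / p2 : ℝ) : ℂ) * c22 ∧
      c21 = ((m3 / p3 : ℝ) : ℂ) * c31 +
            ((τ3 / p3 : ℝ) : ℂ) *
              Complex.exp (-(Complex.I * ((ω2 * (2 * lam + 1) : ℝ) : ℂ))) * c32 ∧
      c22 = ((τ3 / p3 : ℝ) : ℂ) *
              Complex.exp (Complex.I * ((ω2 * (2 * lam + 1) : ℝ) : ℂ)) * c31 +
            ((m3 / p3 : ℝ) : ℂ) * c32) ↔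
    0 = p1 * p2 * p3 - m1 * m2 * m3 * Real.cos (2 * Real.pi * lam)
      - m1 * τ2 * τ3 * Real.cos ((ω2 - ω) * (2 * lam + 1) - 2 * Real.pi * lam)
      - m2 * τ1 * τ3 * Real.cos (-(ω + ω2) * (2 * lam + 1) + 2 * Real.pi * lam)
      - m3 * τ1 * τ2 * Real.cos (2 * ω * (2 * lam + 1) - 2 * Real.pi * lam) := by
  intro p1 p2 p3 m1 m2 m3
  have hp1 : p1 ≠ 0 := one_sub_sq_div_four_ne_zero h1 h1'
  have hp2 : p2 ≠ 0 := one_sub_sq_div_four_ne_zero h2 h2'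
  have hp3 : p3 ≠ 0 := one_sub_sq_div_four_ne_zero h3 h3'
  have hm1 : m1 ^ 2 - τ1 ^ 2 = p1 ^ 2 := by simp only [m1, p1]; ring
  have hm2 : m2 ^ 2 - τ2 ^ 2 = p2 ^ 2 := by simp only [m2, p2]; ring
  have hm3 : m3 ^ 2 - τ3 ^ 2 = p3 ^ 2 := by simp only [m3, p3]; ring
  clear_value p1 p2 p3 m1 m2 m3
  have hF : Complex.exp (Complex.I * ((ω * (2 * lam + 1) - 2 * Real.pi * lam : ℝ) : ℂ)) =
      Complex.exp (Complex.I * ((ω * (2 * lam + 1) : ℝ) : ℂ)) *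
        (Complex.exp (2 * (Real.pi : ℂ) * Complex.I * (lam : ℂ)))⁻¹ := by
    rw [← Complex.exp_neg, ← Complex.exp_add]
    congr 1
    push_cast
    ring
  simp only [Complex.exp_neg, hF, Complex.ofReal_div]
  rw [exists_transmission_solution_iff (mod_cast hp1) (mod_cast hp2) (mod_cast hp3)
    (mod_cast hm1) (mod_cast hm2) (mod_cast hm3) (Complex.exp_ne_zero _)
    (Complex.exp_ne_zero _) (Complex.exp_ne_zero _)]
  rw [ofReal_two_mul_cos_eq_of_exp_eq (x := 2 * Real.pi * lam)
      (by congr 1; push_cast; ring),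
    ofReal_two_mul_cos_eq_of_exp_eq (x := (ω2 - ω) * (2 * lam + 1) - 2 * Real.pi * lam)
      (by simp only [← Complex.exp_neg, ← Complex.exp_add]; congr 1; push_cast; ring),
    ofReal_two_mul_cos_eq_of_exp_eq (x := (ω + ω2) * (2 * lam + 1) - 2 * Real.pi * lam)
      (by simp only [← Complex.exp_neg, ← Complex.exp_add]; congr 1; push_cast; ring),
    ofReal_two_mul_cos_eq_of_exp_eq (x := 2 * ω * (2 * lam + 1) - 2 * Real.pi * lam)
      (by simp only [sq, ← Complex.exp_neg, ← Complex.exp_add]; congr 1; push_cast; ring)]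
  rw [show -(ω + ω2) * (2 * lam + 1) + 2 * Real.pi * lam =
    -((ω + ω2) * (2 * lam + 1) - 2 * Real.pi * lam) by ring, Real.cos_neg]
  norm_cast
  constructor <;> intro h <;> linarith
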